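/- For every n and every c with 2 ≤ c ≤ n², there exists an n×n board with at most c colours whose minimum number of Flood-It moves is at least √(c-1)·n/2 − c/2. -/

import Mathlib

/-- Tiles of an `n × n` board. -/
abbrev Tile (n : ℕ) := Fin n × Fin n

/-- Two tiles are adjacent if they differ by a unit step (horizontally or vertically). -/
def adjT {n : ℕ} (p q : Tile n) : Prop :=
  ((p.1 : ℤ) - (q.1 : ℤ)).natAbs + ((p.2 : ℤ) - (q.2 : ℤ)).natAbs = 1

/-- A board assigns one of `c` colours to each tile. -/
abbrev Board (n c : ℕ) := Tile n → Fin c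

/-- `SameColorConn B p q` : `q` is in the monochromatic connected region of `B`
containing `p`. -/
def SameColorConn {n c : ℕ} (B : Board n c) (p q : Tile n) : Prop :=
  Relation.ReflTransGen (fun a b => adjT a b ∧ B a = B b) p q

open Classical in
/-- A Flood-It move: recolour the monochromatic region containing `o` with colour `k`. -/
noncomputable def flood {n c : ℕ} (B : Board n c) (o : Tile n) (k : Fin c) : Board n c :=
  fun p => if SameColorConn B o p then k else B p

/-- Play a sequence of Flood-It moves (flooding from `o`). -/
noncomputable def playMoves {n c : ℕ} (o : Tile n) : Board n c → List (Fin c) → Board n c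
  | B, [] => B
  | B, k :: ks => playMoves o (flood B o k) ks

/-- A board is flooded when it is monochromatic. -/
def Flooded {n c : ℕ} (B : Board n c) : Prop := ∀ p q : Tile n, B p = B q

/-- `floodMoves B o` : the minimum number of moves (flooding from `o`) needed to
flood the board `B`. -/
noncomputable def floodMoves {n c : ℕ} (B : Board n c) (o : Tile n) : ℕ :=
  sInf {l : ℕ | ∃ ms : List (Fin c), ms.length = l ∧ Flooded (playMoves o B ms)}

/-- The `ℓ¹` distance between two tiles. -/
def tileDist {n : ℕ} (p z : Tile n) : ℕ :=
  ((p.1 : ℤ) - (z.1 : ℤ)).natAbs + ((p.2 : ℤ) - (z.2 : ℤ)).natAbs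

lemma tileDist_self {n : ℕ} (z : Tile n) : tileDist z z = 0 := by
  simp [tileDist]

lemma tileDist_le_of_adjT {n : ℕ} {p q : Tile n} (h : adjT p q) (z : Tile n) :
    tileDist p z ≤ tileDist q z + 1 := by
  unfold adjT at h
  unfold tileDist
  omega

lemma tileDist_triangle {n : ℕ} (p z w : Tile n) :
    tileDist z w ≤ tileDist p z + tileDist p w := by
  unfold tileDist
  omega

/-- Every tile can be reached from the top-left tile by unit steps. -/
lemma reflTransGen_adjT_corner {n : ℕ} (hn : 1 ≤ n) (p : Tile n) :
    Relation.ReflTransGen adjT ((⟨0, hn⟩, ⟨0, hn⟩) : Tile n) p := by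
  have row : ∀ x (hx : x < n),
      Relation.ReflTransGen adjT ((⟨0, hn⟩, ⟨0, hn⟩) : Tile n) (⟨x, hx⟩, ⟨0, hn⟩) := by
    intro x
    induction x with
    | zero => intro _; exact .refl
    | succ x ih =>
      intro hx
      refine (ih (by omega)).tail ?_
      simp [adjT]
  have all : ∀ y (hy : y < n), Relation.ReflTransGen adjT
      ((⟨0, hn⟩, ⟨0, hn⟩) : Tile n) (p.1, ⟨y, hy⟩) := by
    intro y
    induction y with
    | zero => intro _; exact row p.1 p.1.2
    | succ y ih =>
      intro hy
      refine (ih (by omega)).tail ?_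
      simp [adjT]
  exact all p.2 p.2.2

lemma SameColorConn.color_eq {n c : ℕ} {B : Board n c} {o p : Tile n}
    (h : SameColorConn B o p) : B p = B o := by
  induction h with
  | refl => rfl
  | tail _ hs ih => exact hs.2.symm.trans ih

lemma flood_of_conn {n c : ℕ} {B : Board n c} {o p : Tile n} (k : Fin c)
    (h : SameColorConn B o p) : flood B o k p = k := by
  simp [flood, h]

lemma flood_of_not_conn {n c : ℕ} {B : Board n c} {o p : Tile n} (k : Fin c)
    (h : ¬ SameColorConn B o p) : flood B o k p = B p := by
  simp [flood, h]

lemma SameColorConn.flood {n c : ℕ} {B : Board n c} {o p : Tile n} (k : Fin c)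
    (h : SameColorConn B o p) : SameColorConn (flood B o k) o p := by
  induction h with
  | refl => exact .refl
  | tail h₁ hs ih =>
    refine Relation.ReflTransGen.tail ih ⟨hs.1, ?_⟩
    rw [flood_of_conn k h₁, flood_of_conn k (Relation.ReflTransGen.tail h₁ hs)]

lemma Flooded.sameColorConn_corner {n c : ℕ} {B : Board n c} (hB : Flooded B) (hn : 1 ≤ n)
    (p : Tile n) : SameColorConn B (⟨0, hn⟩, ⟨0, hn⟩) p :=
  Relation.ReflTransGen.mono (fun a b h => ⟨h, hB a b⟩) _ _ (reflTransGen_adjT_corner hn p)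

/-- Every board can be flooded from the top-left tile. -/
lemma exists_flooded_playMoves {n c : ℕ} (hn : 1 ≤ n) (B : Board n c) :
    ∃ ms : List (Fin c), Flooded (playMoves (⟨0, hn⟩, ⟨0, hn⟩) B ms) := by
  classical
  set o : Tile n := (⟨0, hn⟩, ⟨0, hn⟩) with ho
  induction hN : (Finset.univ.filter fun p => ¬ SameColorConn B o p).card
    using Nat.strong_induction_on generalizing B with
  | _ N ih =>
    by_cases hall : ∀ p, SameColorConn B o p
    · exact ⟨[], fun p q => (hall p).color_eq.trans (hall q).color_eq.symm⟩
    · obtain ⟨q, q', hq, hq', hadj⟩ :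
          ∃ q q', SameColorConn B o q ∧ ¬ SameColorConn B o q' ∧ adjT q q' := by
        by_contra! hcon
        refine hall fun p => ?_
        induction reflTransGen_adjT_corner hn p with
        | refl => exact .refl
        | tail _ hs ih => exact by_contra fun h => hcon _ _ ih h hs
      have hgrow : SameColorConn (flood B o (B q')) o q' := by
        refine Relation.ReflTransGen.tail (hq.flood (B q')) ⟨hadj, ?_⟩
        rw [flood_of_conn _ hq, flood_of_not_conn _ hq']
      obtain ⟨ms, hms⟩ := ih _ (by
        rw [← hN]
        refine Finset.card_lt_card (Finset.ssubset_iff_of_subset ?_ |>.mpr ⟨q', ?_, ?_⟩)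
        · intro p hp
          simp only [Finset.mem_filter, Finset.mem_univ, true_and] at hp ⊢
          exact fun h => hp (h.flood _)
        · simpa using hq'
        · simpa using hgrow) (flood B o (B q')) rfl
      exact ⟨B q' :: ms, hms⟩

/-- A ball coloured by distance to its centre is not entered if its outermost ring avoids the
colour of the flooded region. -/
lemma not_sameColorConn_of_ring {n c : ℕ} {B : Board n c} {o z : Tile n} {f : ℕ → Fin c} {j : ℕ}
    (hf : ∀ p, tileDist p z < j → B p = f (tileDist p z)) (ho : j ≤ tileDist o z)
    (hne : 0 < j → f (j - 1) ≠ B o) (p : Tile n) (hp : tileDist p z < j) :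
    ¬ SameColorConn B o p := by
  suffices h : ∀ q, SameColorConn B o q → j ≤ tileDist q z from
    fun hc => absurd (h p hc) (by omega)
  intro q hq
  induction hq with
  | refl => exact ho
  | @tail a b hab hs ih =>
    by_contra hlt
    have hd := tileDist_le_of_adjT hs.1 z
    have hb : tileDist b z = j - 1 := by omega
    have hcol := SameColorConn.color_eq (Relation.ReflTransGen.tail hab hs)
    rw [hf b (by omega), hb] at hcol
    exact hne (by omega) hcol

/-- If the unflooded ball of radius `j` has alternating rings with colours in `S`, then at least
`j` moves with colours in `S` are needed. -/
lemma le_countP_of_alternating {n c : ℕ} (hn : 1 ≤ n) {z : Tile n} {f : ℕ → Fin c}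
    (S : Fin c → Bool) (hS : ∀ d, S (f d) = true) (halt : ∀ d, f d ≠ f (d + 1))
    (ms : List (Fin c)) (B : Board n c) (j : ℕ)
    (hf : ∀ p, tileDist p z < j → B p = f (tileDist p z))
    (hout : ∀ p, tileDist p z < j → ¬ SameColorConn B (⟨0, hn⟩, ⟨0, hn⟩) p)
    (hfl : Flooded (playMoves (⟨0, hn⟩, ⟨0, hn⟩) B ms)) :
    j ≤ ms.countP S := by
  induction ms generalizing B j with
  | nil =>
    by_contra hj
    refine hout z ?_ (Flooded.sameColorConn_corner hfl hn z)
    rw [tileDist_self]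
    simpa [Nat.pos_iff_ne_zero] using hj
  | cons k ks ih =>
    set o : Tile n := (⟨0, hn⟩, ⟨0, hn⟩) with ho
    have hoj : j ≤ tileDist o z := by
      by_contra h
      exact hout o (by omega) .refl
    have hok : flood B o k o = k := flood_of_conn k .refl
    have step : ∀ i ≤ j, (0 < i → f (i - 1) ≠ k) → i ≤ ks.countP S := by
      intro i hi hne
      have hf' : ∀ p, tileDist p z < i → flood B o k p = f (tileDist p z) := fun p hp => by
        rw [flood_of_not_conn k (hout p (by omega)), hf p (by omega)]
      refine ih (flood B o k) i hf' ?_ hfl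
      exact not_sameColorConn_of_ring hf' (by omega) (by rwa [hok])
    rw [List.countP_cons]
    by_cases hk : 0 < j ∧ f (j - 1) = k
    · have h1 : S k = true := hk.2 ▸ hS _
      have := step (j - 1) (by omega) (fun hpos h => by
        have := halt (j - 1 - 1)
        rw [show j - 1 - 1 + 1 = j - 1 by omega, h] at this
        exact this hk.2.symm)
      simp only [h1, if_true]
      omega
    · have := step j le_rfl (fun hpos h => hk ⟨hpos, h⟩)
      omega

lemma sum_countP_div_two_le_length {c : ℕ} (K : ℕ) (ms : List (Fin c)) :
    ∑ i ∈ Finset.range K, ms.countP (fun x => decide (x.val / 2 = i)) ≤ ms.length := by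
  induction ms with
  | nil => simp
  | cons x xs ih =>
    simp only [List.countP_cons, Finset.sum_add_distrib, List.length_cons, decide_eq_true_eq]
    have : ∑ i ∈ Finset.range K, (if x.val / 2 = i then 1 else 0) ≤ 1 := by
      rw [Finset.sum_ite_eq]
      split_ifs <;> simp
    omega

/-- The board made of the diamonds of radius `r` around `z 0, …, z (K - 1)`, the `i`-th one
alternating between the colours `2 * i` and `2 * i + 1`. -/
lemma exists_diamond_board {n c K r : ℕ} (hn : 1 ≤ n) (hK : 0 < K) (hKc : 2 * K ≤ c)
    (z : ℕ → Tile n)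
    (hsep : ∀ i < K, ∀ j < K, i ≠ j → 2 * r ≤ tileDist (z i) (z j))
    (hcorner : ∀ i < K, r ≤ tileDist (⟨0, hn⟩, ⟨0, hn⟩) (z i)) :
    ∃ B : Board n c, K * r ≤ floodMoves B (⟨0, hn⟩, ⟨0, hn⟩) := by
  classical
  set o : Tile n := (⟨0, hn⟩, ⟨0, hn⟩) with ho
  let col : ℕ → ℕ → Fin c := fun i d =>
    if h : i < K then ⟨2 * i + d % 2, by omega⟩ else ⟨0, by omega⟩
  have col_val : ∀ i < K, ∀ d, (col i d).val = 2 * i + d % 2 := fun i hi d => by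
    simp [col, hi]
  let B : Board n c := fun p =>
    if h : ∃ i, i < K ∧ tileDist p (z i) < r then col h.choose (tileDist p (z h.choose))
    else col 0 r
  have hB : ∀ i < K, ∀ p, tileDist p (z i) < r → B p = col i (tileDist p (z i)) := by
    intro i hi p hp
    have h : ∃ i, i < K ∧ tileDist p (z i) < r := ⟨i, hi, hp⟩
    have hi' : h.choose = i := by
      by_contra hne
      have h1 := hsep _ h.choose_spec.1 i hi hne
      have h2 := tileDist_triangle p (z h.choose) (z i)
      have h3 := h.choose_spec.2
      omega
    simp only [B, dif_pos h, hi']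
  have hBo : B o = col 0 r := by
    have h : ¬ ∃ i, i < K ∧ tileDist o (z i) < r := by
      rintro ⟨i, hi, h⟩
      have := hcorner i hi
      omega
    simp only [B, dif_neg h]
  refine ⟨B, le_csInf ?_ ?_⟩
  · obtain ⟨ms, hms⟩ := exists_flooded_playMoves hn B
    exact ⟨_, ms, rfl, hms⟩
  · rintro _ ⟨ms, rfl, hms⟩
    refine le_trans ?_ (sum_countP_div_two_le_length K ms)
    rw [← smul_eq_mul, ← Finset.card_range K, ← Finset.sum_const, Finset.card_range]
    refine Finset.sum_le_sum fun i hi => ?_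
    have hi := Finset.mem_range.mp hi
    refine le_countP_of_alternating hn (z := z i) (f := col i) _ (fun d => ?_) (fun d h => ?_)
      ms B r (hB i hi) ?_ hms
    · simp only [col_val i hi, decide_eq_true_eq]
      omega
    · have := congrArg Fin.val h
      rw [col_val i hi, col_val i hi] at this
      omega
    · refine not_sameColorConn_of_ring (hB i hi) (hcorner i hi) fun hr h => ?_
      have := congrArg Fin.val (h.trans hBo)
      rw [col_val i hi, col_val 0 hK] at this
      omega

/-- An `m × m` grid has `K` distinct cells with odd coordinate sum whenever `2 * K ≤ m ^ 2`. -/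
lemma exists_odd_cells {m K : ℕ} (hmK : 2 * K ≤ m ^ 2) :
    ∃ g : ℕ → ℕ × ℕ, (∀ t < K, (g t).1 < m ∧ (g t).2 < m ∧ ((g t).1 + (g t).2) % 2 = 1) ∧
      ∀ t < K, ∀ u < K, t ≠ u → g t ≠ g u := by
  rcases Nat.eq_zero_or_pos m with rfl | hm
  · exact ⟨fun _ => (0, 0), fun t ht => by omega, fun t ht => by omega⟩
  refine ⟨fun t => ((2 * t + 1) / m,
    if (2 * t + 1) / m % 2 = 0 then (2 * t + 1) % m else m - 1 - (2 * t + 1) % m), ?_, ?_⟩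
  · intro t ht
    have h1 : (2 * t + 1) / m < m := by
      rw [Nat.div_lt_iff_lt_mul hm]
      nlinarith
    have h2 := Nat.mod_lt (2 * t + 1) hm
    have h3 := Nat.div_add_mod (2 * t + 1) m
    have h4 : (m * ((2 * t + 1) / m)) % 2 = (m % 2) * ((2 * t + 1) / m % 2) % 2 :=
      Nat.mul_mod _ _ _
    refine ⟨h1, by dsimp only; split_ifs <;> omega, ?_⟩
    dsimp only
    generalize (2 * t + 1) / m = a at *
    generalize (2 * t + 1) % m = b at *
    rcases Nat.mod_two_eq_zero_or_one m with hm2 | hm2 <;>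
    rcases Nat.mod_two_eq_zero_or_one a with ha2 | ha2 <;>
    simp only [hm2, ha2] at h4 ⊢ <;> simp at h4 ⊢ <;> omega
  · intro t ht u hu htu h
    simp only [Prod.mk.injEq] at h
    obtain ⟨h1, h2⟩ := h
    have h3 := Nat.div_add_mod (2 * t + 1) m
    have h4 := Nat.div_add_mod (2 * u + 1) m
    have h5 := Nat.mod_lt (2 * t + 1) hm
    have h6 := Nat.mod_lt (2 * u + 1) hm
    rw [h1] at h2 h3
    split_ifs at h2 <;> omega

/-- If `2 * K * r ^ 2 ≤ n ^ 2`, then the board has room for `K` centres at mutual distance at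
least `2 * r`, and at distance at least `r` from the corner. -/
lemma exists_diamond_centers {n K r : ℕ} (hn : 1 ≤ n) (hr : 1 ≤ r)
    (hKr : 2 * K * r ^ 2 ≤ n ^ 2) :
    ∃ z : ℕ → Tile n, (∀ i < K, ∀ j < K, i ≠ j → 2 * r ≤ tileDist (z i) (z j)) ∧
      ∀ i < K, r ≤ tileDist (⟨0, hn⟩, ⟨0, hn⟩) (z i) := by
  set m := (n - 1) / r + 1 with hm
  have hnm : n ≤ m * r := by
    have h1 := Nat.div_add_mod (n - 1) r
    have h2 := Nat.mod_lt (n - 1) hr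
    have : m * r = r * ((n - 1) / r) + r := by rw [hm]; ring
    omega
  have hmK : 2 * K ≤ m ^ 2 := by
    have h1 : 2 * K * r ^ 2 ≤ m ^ 2 * r ^ 2 := by
      rw [← mul_pow]
      exact hKr.trans (Nat.pow_le_pow_left hnm 2)
    exact Nat.le_of_mul_le_mul_right h1 (by positivity)
  have hlt : ∀ a < m, r * a < n := by
    intro a ha
    have h1 : r * a ≤ r * ((n - 1) / r) := Nat.mul_le_mul_left r (by omega)
    have h2 := Nat.mul_div_le (n - 1) r
    omega
  obtain ⟨g, hg, hinj⟩ := exists_odd_cells hmK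
  refine ⟨fun t => if h : r * (g t).1 < n ∧ r * (g t).2 < n
    then (⟨r * (g t).1, h.1⟩, ⟨r * (g t).2, h.2⟩) else (⟨0, hn⟩, ⟨0, hn⟩), ?_, ?_⟩
  · intro i hi j hj hij
    obtain ⟨h1, h2, h3⟩ := hg i hi
    obtain ⟨h4, h5, h6⟩ := hg j hj
    have h7 : ¬ ((g i).1 = (g j).1 ∧ (g i).2 = (g j).2) := fun h => hinj i hi j hj hij
      (Prod.ext h.1 h.2)
    simp only [hlt _ h1, hlt _ h2, hlt _ h4, hlt _ h5, and_self, dif_pos, tileDist]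
    push_cast
    rw [← mul_sub, ← mul_sub, Int.natAbs_mul, Int.natAbs_mul, ← mul_add, Int.natAbs_natCast,
      mul_comm]
    exact Nat.mul_le_mul_left r (by omega)
  · intro i hi
    obtain ⟨h1, h2, h3⟩ := hg i hi
    simp only [hlt _ h1, hlt _ h2, and_self, dif_pos, tileDist]
    push_cast
    rw [zero_sub, zero_sub, Int.natAbs_neg, Int.natAbs_neg, Int.natAbs_mul, Int.natAbs_mul,
      ← mul_add, Int.natAbs_natCast]
    exact Nat.le_mul_of_pos_right r (by omega)

/-- for 2 ≤ c ≤ n², there is an n×n board with at most c colours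
requiring at least √(c-1)·n/2 − c/2 flooding moves. -/
theorem stmt11 (n c : ℕ) (hn : 1 ≤ n) (hc : 2 ≤ c) (hcn : c ≤ n ^ 2) :
    ∃ B : Board n c,
      Real.sqrt ((c : ℝ) - 1) * n / 2 - c / 2 ≤ (floodMoves B (⟨0, hn⟩, ⟨0, hn⟩) : ℝ) := by
  obtain ⟨K, hK⟩ : ∃ K, K = c / 2 := ⟨_, rfl⟩
  have hK0 : 0 < K := by omega
  have hKc : 2 * K ≤ c := by omega
  have hcK : (c : ℝ) - 1 ≤ 2 * K := by
    have : c ≤ 2 * K + 1 := by omega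
    have : (c : ℝ) ≤ 2 * K + 1 := by exact_mod_cast this
    linarith
  set s := Real.sqrt (2 * K) with hs
  have hK0' : (0 : ℝ) < 2 * K := by positivity
  have hs0 : 0 < s := Real.sqrt_pos.mpr hK0'
  have hs2 : s ^ 2 = 2 * K := Real.sq_sqrt hK0'.le
  have hsn : s ≤ n := by
    have : ((2 * K : ℕ) : ℝ) ≤ ((n ^ 2 : ℕ) : ℝ) := by exact_mod_cast hKc.trans hcn
    push_cast at this
    exact Real.sqrt_le_left (by positivity) |>.mpr this
  obtain ⟨r, hr⟩ : ∃ r, r = ⌊(n : ℝ) / s⌋₊ := ⟨_, rfl⟩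
  have hr1 : 1 ≤ r := by
    rw [hr]
    exact Nat.le_floor (by rw [Nat.cast_one, le_div_iff₀ hs0]; linarith)
  have hrle : r * s ≤ n := by
    rw [← le_div_iff₀ hs0, hr]
    exact Nat.floor_le (by positivity)
  have hrlt : (n : ℝ) < (r + 1) * s := by
    rw [← div_lt_iff₀ hs0, hr]
    exact Nat.lt_floor_add_one _
  have hKr : 2 * K * r ^ 2 ≤ n ^ 2 := by
    have h : (2 * K * r ^ 2 : ℝ) ≤ n ^ 2 := by
      rw [← hs2, ← mul_pow, mul_comm]
      exact pow_le_pow_left₀ (by positivity) hrle 2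
    exact_mod_cast h
  obtain ⟨z, hsep, hcorner⟩ := exists_diamond_centers hn hr1 hKr
  obtain ⟨B, hB⟩ := exists_diamond_board hn hK0 hKc z hsep hcorner
  refine ⟨B, ?_⟩
  have hB' : (K * r : ℝ) ≤ (floodMoves B (⟨0, hn⟩, ⟨0, hn⟩) : ℝ) := by exact_mod_cast hB
  refine le_trans ?_ hB'
  have h1 : Real.sqrt ((c : ℝ) - 1) * n ≤ s * n :=
    mul_le_mul_of_nonneg_right (Real.sqrt_le_sqrt hcK) (by positivity)
  have h2 : s * n ≤ 2 * K * (r + 1) := by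
    rw [← hs2]
    nlinarith
  have h3 : (2 * K : ℝ) ≤ c := by exact_mod_cast hKc
  linarith
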